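/- Let N_line ≥ 1, N_g ≥ 0, N_load ≥ 0 and set N_tot = N_line + N_g + N_load. Consider bus assignments f : Fin N_line ⊕ Fin N_g ⊕ Fin N_load → Bool (assigning every line, generator and load of the substation to one of the two busbars). Call f valid if every bus that hosts at least one generator or load also hosts at least one line; equivalently, it is NOT the case that all N_line lines are assigned to one bus while some generator or load is assigned to the other bus. Two assignments are considered the same topology if one is obtained from the other by swapping the roles of the two buses (i.e., f ~ g iff g = not ∘ f or g = f). Then the number of equivalence classes of valid assignments equals 2^(N_tot − 1) − 2^(N_g + N_load) + 1. -/

import Mathlib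

/-- The elements of a double busbar substation with `nl` lines, `ng` generators
and `nld` loads. -/
abbrev Elem (nl ng nld : ℕ) := Fin nl ⊕ (Fin ng ⊕ Fin nld)

/-- A bus assignment `f` is valid if it is NOT the case that all lines are on one
bus `b` while some generator or load is on the other bus `!b`; equivalently every
bus hosting a generator or load also hosts a line. -/
def Valid {nl ng nld : ℕ} (f : Elem nl ng nld → Bool) : Prop :=
  ¬ ∃ b : Bool, (∀ i : Fin nl, f (Sum.inl i) = b) ∧
      (∃ x : Fin ng ⊕ Fin nld, f (Sum.inr x) = !b)

instance {nl ng nld : ℕ} : DecidablePred (@Valid nl ng nld) := fun f => by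
  unfold Valid; infer_instance

/-- Two valid assignments represent the same topology iff they are equal or
differ by swapping the two buses (composing with Boolean negation). -/
def topoSetoid (nl ng nld : ℕ) :
    Setoid {f : Elem nl ng nld → Bool // Valid f} where
  r a b := b.1 = (fun x => !(a.1 x)) ∨ b.1 = a.1
  iseqv := by
    constructor
    · intro a; exact Or.inr rfl
    · intro a b h
      rcases h with h | h
      · left; funext x; simp [h]
      · right; rw [h]
    · intro a b c hab hbc
      rcases hab with h1 | h1 <;> rcases hbc with h2 | h2
      · right; funext x; simp [h2, h1]
      · left; rw [h2, h1]
      · left; rw [h2, h1]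
      · right; rw [h2, h1]

instance (nl ng nld : ℕ) : DecidableRel (topoSetoid nl ng nld).r := fun a b =>
  decidable_of_iff (b.1 = (fun x => !(a.1 x)) ∨ b.1 = a.1) Iff.rfl

instance (nl ng nld : ℕ) : Fintype (Quotient (topoSetoid nl ng nld)) :=
  @Quotient.fintype _ _ (topoSetoid nl ng nld)
    (fun a b => decidable_of_iff (b.1 = (fun x => !(a.1 x)) ∨ b.1 = a.1) Iff.rfl)

/-- Pairs whose second entry is forced to be `b` as soon as the first one is `a`. -/
theorem card_prod_eq_imp_eq {α β : Type*} [Fintype α] [Fintype β] [DecidableEq α]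
    [DecidableEq β] (a : α) (b : β) :
    Fintype.card {p : α × β // p.1 = a → p.2 = b} + Fintype.card β =
      Fintype.card α * Fintype.card β + 1 := by
  have hbad : Finset.univ.filter (fun p : α × β => ¬ (p.1 = a → p.2 = b)) =
      {a} ×ˢ Finset.univ.erase b := by
    ext ⟨x, y⟩
    simp only [Finset.mem_filter_univ, Classical.not_imp, Finset.mem_product,
      Finset.mem_singleton, Finset.mem_erase, Finset.mem_univ, and_true, ne_eq]
  have hsplit := Finset.card_filter_add_card_filter_not (s := Finset.univ)
    (fun p : α × β => p.1 = a → p.2 = b)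
  rw [hbad, Finset.card_product, Finset.card_singleton, one_mul,
    Finset.card_erase_of_mem (Finset.mem_univ b), Finset.card_univ, Finset.card_univ,
    Fintype.card_prod] at hsplit
  have hpos : 0 < Fintype.card β := Fintype.card_pos_iff.mpr ⟨b⟩
  rw [Fintype.card_subtype]
  omega

/-- The assignment that puts the first line on bus `false`, the other lines according to `u`
and the generators and loads according to `v`. -/
def normalAssignment {n ng nld : ℕ} (u : Fin n → Bool) (v : Fin ng ⊕ Fin nld → Bool) :
    Elem (n + 1) ng nld → Bool :=
  Sum.elim (Fin.cons false u) v

theorem valid_normalAssignment_iff {n ng nld : ℕ} (u : Fin n → Bool)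
    (v : Fin ng ⊕ Fin nld → Bool) :
    Valid (normalAssignment u v) ↔ (u = (fun _ => false) → v = fun _ => false) := by
  simp only [Valid, normalAssignment, Sum.elim_inl, Sum.elim_inr, Fin.forall_fin_succ,
    Fin.cons_zero, Fin.cons_succ, funext_iff]
  constructor
  · intro h hu x
    by_contra hx
    exact h ⟨false, ⟨rfl, hu⟩, x, by simpa using hx⟩
  · rintro h ⟨b, ⟨rfl, hu⟩, x, hx⟩
    simp [h hu x] at hx

theorem valid_not_iff {nl ng nld : ℕ} (f : Elem nl ng nld → Bool) :
    Valid (fun x => !f x) ↔ Valid f := by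
  simp only [Valid, Bool.exists_bool, Bool.not_eq_eq_eq_not, Bool.not_not, Bool.not_false,
    Bool.not_true]
  tauto

theorem exists_normalAssignment_eq {n ng nld : ℕ} (f : Elem (n + 1) ng nld → Bool)
    (hf : f (Sum.inl 0) = false) : ∃ u v, normalAssignment u v = f := by
  refine ⟨fun i => f (Sum.inl i.succ), fun x => f (Sum.inr x), funext ?_⟩
  rintro (i | x)
  · cases i using Fin.cases <;> simp [normalAssignment, hf]
  · rfl

theorem normalAssignment_injective {n ng nld : ℕ} {u u' : Fin n → Bool}
    {v v' : Fin ng ⊕ Fin nld → Bool} (h : normalAssignment u v = normalAssignment u' v') :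
    u = u' ∧ v = v' :=
  ⟨funext fun i => by simpa [normalAssignment] using congrFun h (Sum.inl i.succ),
    funext fun x => congrFun h (Sum.inr x)⟩

/-- Every topology has exactly one representative with the first line on bus `false`. -/
theorem bijective_mk_normalAssignment (n ng nld : ℕ) :
    Function.Bijective
      (fun p : {p : (Fin n → Bool) × (Fin ng ⊕ Fin nld → Bool) //
          p.1 = (fun _ => false) → p.2 = fun _ => false} =>
        (Quotient.mk (topoSetoid (n + 1) ng nld)
          ⟨normalAssignment p.1.1 p.1.2, (valid_normalAssignment_iff _ _).mpr p.2⟩)) := by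
  constructor
  · rintro ⟨⟨u, v⟩, hp⟩ ⟨⟨u', v'⟩, hq⟩ h
    rcases Quotient.exact h with h | h
    · have h0 := congrFun h (Sum.inl 0)
      simp [normalAssignment] at h0
    · obtain ⟨rfl, rfl⟩ := normalAssignment_injective h
      rfl
  · refine fun q => Quotient.inductionOn q ?_
    rintro ⟨f, hf⟩
    cases h0 : f (Sum.inl 0) with
    | false =>
      obtain ⟨u, v, rfl⟩ := exists_normalAssignment_eq f h0
      exact ⟨⟨(u, v), (valid_normalAssignment_iff _ _).mp hf⟩, rfl⟩
    | true =>
      obtain ⟨u, v, huv⟩ := exists_normalAssignment_eq (fun x => !f x) (by simp [h0])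
      refine ⟨⟨(u, v), (valid_normalAssignment_iff _ _).mp ?_⟩, Quotient.sound (Or.inl ?_)⟩
      · rwa [huv, valid_not_iff]
      · simp [huv]

/-- The number of bus-swap equivalence classes of valid bus assignments of a
double busbar substation with `nl ≥ 1` lines, `ng` generators and `nld` loads
is `2 ^ (N_tot - 1) - 2 ^ (ng + nld) + 1` where `N_tot = nl + ng + nld`. -/
theorem card_valid_topologies (nl ng nld : ℕ) (hnl : 1 ≤ nl) :
    Fintype.card (Quotient (topoSetoid nl ng nld)) =
      2 ^ (nl + ng + nld - 1) - 2 ^ (ng + nld) + 1 := by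
  obtain ⟨n, rfl⟩ := Nat.exists_eq_add_of_le' hnl
  have hcount := card_prod_eq_imp_eq (fun _ : Fin n => false)
    (fun _ : Fin ng ⊕ Fin nld => false)
  rw [Fintype.card_of_bijective (bijective_mk_normalAssignment n ng nld)] at hcount
  simp only [Fintype.card_fun, Fintype.card_bool, Fintype.card_sum, Fintype.card_fin,
    ← pow_add] at hcount
  have hle : 2 ^ (ng + nld) ≤ 2 ^ (n + (ng + nld)) :=
    Nat.pow_le_pow_right two_pos (Nat.le_add_left _ _)
  rw [show n + 1 + ng + nld - 1 = n + (ng + nld) by omega]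
  omega
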